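/- Mellin transform of the inverse Kontorovich–Lebedev transform: Fix η > 40, let H ∈ C_η and set h := H^♭. Then for every w ∈ ℂ with −1/2 < Re w < η, the Mellin transform ĥ(w) := ∫₀^∞ h(y) y^{w−1} dy converges absolutely and equals (π^{−w−1/2}/4) · (1/(2π)) ∫_ℝ H(it) · Γ((w + 1/2 + it)/2) · Γ((w + 1/2 − it)/2) / (Γ(it)Γ(−it)) dt. -/

import Mathlib

open Complex MeasureTheory Set

/-- The K-Bessel function `K_μ(x) = ∫₀^∞ exp(−x cosh t) cosh(μt) dt`. -/
noncomputable def KBessel (μ : ℂ) (x : ℝ) : ℂ :=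
  ∫ t in Ioi (0:ℝ), Complex.exp (-(x : ℂ) * (Real.cosh t : ℂ)) * Complex.cosh (μ * (t : ℂ))

/-- The GL(2) Whittaker function `W_μ(y) = 2√y K_μ(2πy)`. -/
noncomputable def W2 (μ : ℂ) (y : ℝ) : ℂ :=
  2 * (Real.sqrt y : ℂ) * KBessel μ (2 * Real.pi * y)

/-- The class `C_η` of test functions: holomorphic on `|Re μ| < 2η`, even, and with
rapid decay `|H(μ)| ≤ C exp(−2π|Im μ|)` on the strip. -/
def MemCeta (η : ℝ) (H : ℂ → ℂ) : Prop :=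
  DifferentiableOn ℂ H {μ : ℂ | |μ.re| < 2 * η} ∧
  (∀ μ : ℂ, |μ.re| < 2 * η → H (-μ) = H μ) ∧
  ∃ C : ℝ, ∀ μ : ℂ, |μ.re| < 2 * η → ‖H μ‖ ≤ C * Real.exp (-2 * Real.pi * |μ.im|)

/-- The inverse Kontorovich–Lebedev transform
`H^♭(y) := (1/(4π)) ∫_ℝ H(it) W_{it}(y) / (Γ(it)Γ(−it)) dt`. -/
noncomputable def Hflat (H : ℂ → ℂ) (y : ℝ) : ℂ :=
  (1 / (4 * (Real.pi : ℂ))) * ∫ t : ℝ,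
    H (t * I) * W2 (t * I) y / (Complex.Gamma (t * I) * Complex.Gamma (-(t * I)))

theorem inv_Gamma_mul_Gamma_neg (z : ℂ) :
    (Gamma z * Gamma (-z))⁻¹ = -z * sin (Real.pi * z) / Real.pi := by
  rcases eq_or_ne z 0 with rfl | hz
  · simp
  have h : Gamma z * Gamma (-z) = (Real.pi / sin (Real.pi * z)) / (-z) := by
    rw [← Gamma_mul_Gamma_one_sub, show (1 : ℂ) - z = -z + 1 by ring,
      Gamma_add_one _ (neg_ne_zero.2 hz)]
    field_simp
  rw [h, inv_div, div_div_eq_mul_div]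

theorem integrable_exp_neg_mul_abs {b : ℝ} (hb : 0 < b) :
    Integrable fun x : ℝ => Real.exp (-b * |x|) := by
  rw [← integrableOn_univ, ← Iic_union_Ioi (a := (0 : ℝ)), integrableOn_union]
  constructor
  · refine (integrableOn_exp_mul_Iic hb 0).congr_fun (fun x hx => ?_) measurableSet_Iic
    simp [abs_of_nonpos (mem_Iic.1 hx)]
  · refine (exp_neg_integrableOn_Ioi 0 hb).congr_fun (fun x hx => ?_) measurableSet_Ioi
    simp [abs_of_pos (mem_Ioi.1 hx)]

theorem MemCeta.integrable_div_Gamma {η : ℝ} (hη : 0 < η) {H : ℂ → ℂ} (hH : MemCeta η H) :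
    Integrable fun t : ℝ => H (t * I) / (Gamma (t * I) * Gamma (-(t * I))) := by
  obtain ⟨hdiff, -, C, hC⟩ := hH
  have hmem (t : ℝ) : |((t : ℂ) * I).re| < 2 * η := by simpa using hη
  have hcont : Continuous fun t : ℝ => H (t * I) :=
    hdiff.continuousOn.comp_continuous (by fun_prop) hmem
  simp only [div_eq_mul_inv, inv_Gamma_mul_Gamma_neg]
  refine ((integrable_exp_neg_mul_abs zero_lt_one).const_mul C).mono'
    (hcont.mul (by fun_prop)).aestronglyMeasurable (.of_forall fun t => ?_)
  have hH' := hC (t * I) (hmem t)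
  have hC0 : 0 ≤ C := by
    have := (norm_nonneg _).trans hH'
    exact nonneg_of_mul_nonneg_left this (Real.exp_pos _)
  have hsin : ‖sin (Real.pi * (t * I))‖ ≤ Real.exp (Real.pi * |t|) := by
    rw [← mul_assoc, ← ofReal_mul, sin_mul_I, norm_mul, norm_I, mul_one, ← ofReal_sinh,
      norm_real, Real.norm_eq_abs, Real.abs_sinh, abs_mul, abs_of_pos Real.pi_pos]
    exact (Real.sinh_lt_cosh _).le.trans (by
      rw [← Real.cosh_add_sinh]
      linarith [Real.sinh_nonneg_iff.2 (show 0 ≤ Real.pi * |t| by positivity)])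
  have ht : |t| ≤ Real.exp |t| := by linarith [Real.add_one_le_exp |t|]
  have h2 : Real.exp (Real.pi * |t|) / Real.pi ≤ Real.exp (Real.pi * |t|) :=
    div_le_self (Real.exp_pos _).le (by linarith [Real.pi_gt_three])
  calc _ = ‖H (t * I)‖ * (|t| * (‖sin (Real.pi * (t * I))‖ / Real.pi)) := by
        simp only [norm_mul, norm_neg, norm_inv, norm_real, norm_I, Real.norm_eq_abs,
          abs_of_pos Real.pi_pos]
        ring
    _ ≤ (C * Real.exp (-2 * Real.pi * |t|)) * (Real.exp |t| * Real.exp (Real.pi * |t|)) := by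
        gcongr
        · simpa using hH'
        · exact (by gcongr : _ ≤ _).trans h2
    _ = C * Real.exp (-(Real.pi - 1) * |t|) := by
        rw [mul_assoc, ← Real.exp_add, ← Real.exp_add]; ring_nf
    _ ≤ _ := by
        gcongr
        linarith [Real.pi_gt_three]

theorem norm_two_mul_cosh_cpow_le {s : ℂ} (hs : 0 < s.re) (u : ℝ) :
    ‖((2 * Real.cosh u : ℝ) : ℂ) ^ (-s)‖ ≤ Real.exp (-s.re * |u|) := by
  have hc := Real.cosh_pos u
  rw [norm_cpow_eq_rpow_re_of_pos (by positivity), mul_comm (-s.re), Real.exp_mul, neg_re]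
  refine Real.rpow_le_rpow_of_nonpos (Real.exp_pos _) ?_ (by linarith)
  rw [← Real.cosh_abs, ← Real.cosh_add_sinh]
  linarith [Real.sinh_lt_cosh |u|]

theorem ofReal_exp_div_cpow (v : ℝ) {c : ℝ} (hc : 0 < c) (a : ℂ) :
    ((Real.exp v / c : ℝ) : ℂ) ^ a = exp (a * v) * (c : ℂ) ^ (-a) := by
  have hv := Real.exp_pos v
  rw [cpow_def_of_ne_zero (ofReal_ne_zero.2 (by positivity)),
    cpow_def_of_ne_zero (ofReal_ne_zero.2 hc.ne'), ← ofReal_log (by positivity),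
    ← ofReal_log hc.le, Real.log_div hv.ne' hc.ne', Real.log_exp, ← exp_add]
  push_cast
  ring_nf

theorem betaIntegral_eq_integral_cosh (a b : ℂ) :
    betaIntegral a b =
      2 * ∫ u : ℝ, exp ((a - b) * u) * ((2 * Real.cosh u : ℝ) : ℂ) ^ (-(a + b)) := by
  have hderiv (u : ℝ) : HasDerivAt (fun u => Real.sigmoid (2 * u))
      (Real.sigmoid (2 * u) * (1 - Real.sigmoid (2 * u)) * 2) u :=
    HasDerivAt.comp (h₂ := Real.sigmoid) u (Real.hasDerivAt_sigmoid (2 * u)) (by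
      simpa using (hasDerivAt_id u).const_mul 2)
  have himage : (fun u => Real.sigmoid (2 * u)) '' univ = Ioo 0 1 := by
    rw [image_univ, ← Real.range_sigmoid]
    exact (mul_left_surjective₀ (two_ne_zero (α := ℝ))).range_comp Real.sigmoid
  rw [betaIntegral, intervalIntegral.integral_of_le zero_le_one, integral_Ioc_eq_integral_Ioo,
    ← himage, integral_image_eq_integral_abs_deriv_smul MeasurableSet.univ
      (fun u _ => (hderiv u).hasDerivWithinAt)
      (fun u _ v _ h => by simpa using Real.sigmoid_injective h),
    Measure.restrict_univ, ← integral_const_mul]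
  refine integral_congr_ae (.of_forall fun u => ?_)
  have hp := Real.sigmoid_pos (2 * u)
  have hq : 0 < 1 - Real.sigmoid (2 * u) := by linarith [Real.sigmoid_lt_one (2 * u)]
  have hc : 0 < 2 * Real.cosh u := by linarith [Real.cosh_pos u]
  have e1 : Real.sigmoid (2 * u) = Real.exp u / (2 * Real.cosh u) := by
    rw [Real.sigmoid_def, Real.cosh_eq, show -(2 * u) = -u + -u by ring, Real.exp_add, Real.exp_neg]
    field_simp
  have e2 : 1 - Real.sigmoid (2 * u) = Real.exp (-u) / (2 * Real.cosh u) := by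
    rw [e1, eq_div_iff hc.ne', sub_mul, div_mul_cancel₀ _ hc.ne', Real.cosh_eq]
    ring
  have h1 : ((Real.sigmoid (2 * u) : ℝ) : ℂ) ^ a =
      exp (a * u) * ((2 * Real.cosh u : ℝ) : ℂ) ^ (-a) := by
    rw [e1, ofReal_exp_div_cpow u hc]
  have h2 : ((1 - Real.sigmoid (2 * u) : ℝ) : ℂ) ^ b =
      exp (-(b * u)) * ((2 * Real.cosh u : ℝ) : ℂ) ^ (-b) := by
    rw [e2, ofReal_exp_div_cpow (-u) hc, ofReal_neg, mul_neg]
  have h3 : exp ((a - b) * u) * ((2 * Real.cosh u : ℝ) : ℂ) ^ (-(a + b)) =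
      ((Real.sigmoid (2 * u) : ℝ) : ℂ) ^ a * ((1 - Real.sigmoid (2 * u) : ℝ) : ℂ) ^ b := by
    rw [h1, h2, neg_add, cpow_add _ _ (ofReal_ne_zero.2 hc.ne'), sub_mul, sub_eq_add_neg, exp_add]
    ring_nf
  beta_reduce
  rw [h3, abs_of_pos (by positivity), real_smul, ← ofReal_one, ← ofReal_sub,
    cpow_sub _ _ (ofReal_ne_zero.2 hp.ne'), cpow_sub _ _ (ofReal_ne_zero.2 hq.ne')]
  have := ofReal_ne_zero.2 hp.ne'
  have := ofReal_ne_zero.2 hq.ne'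
  simp only [ofReal_one, cpow_one, ofReal_mul, ofReal_ofNat]
  field_simp

theorem norm_cosh_ofReal_mul_I_mul_le_one (t u : ℝ) : ‖cosh (t * I * u)‖ ≤ 1 := by
  rw [show (t : ℂ) * I * u = ((t * u : ℝ) : ℂ) * I by push_cast; ring, cosh_mul_I, ← ofReal_cos,
    norm_real]
  exact Real.abs_cos_le_one _

theorem integral_cosh_mul_two_mul_cosh_cpow {s : ℂ} (hs : 0 < s.re) (t : ℝ) :
    Gamma s * (4 * ∫ u in Ioi (0 : ℝ), cosh (t * I * u) * ((2 * Real.cosh u : ℝ) : ℂ) ^ (-s)) =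
      Gamma ((s + t * I) / 2) * Gamma ((s - t * I) / 2) := by
  have h_int : Integrable fun u : ℝ => exp (t * I * u) * ((2 * Real.cosh u : ℝ) : ℂ) ^ (-s) := by
    refine (integrable_exp_neg_mul_abs hs).mono' ?_ (.of_forall fun u => ?_)
    · exact Measurable.aestronglyMeasurable (by fun_prop)
    · rw [norm_mul, show (t : ℂ) * I * u = ((t * u : ℝ) : ℂ) * I by push_cast; ring,
        norm_exp_ofReal_mul_I, one_mul]
      exact norm_two_mul_cosh_cpow_le hs u
  rw [Gamma_mul_Gamma_eq_betaIntegral (by simpa using hs) (by simpa using hs),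
    betaIntegral_eq_integral_cosh, show (s + t * I) / 2 + (s - t * I) / 2 = s by ring,
    show (s + t * I) / 2 - (s - t * I) / 2 = t * I by ring,
    ← intervalIntegral.integral_Iic_add_Ioi (b := 0) h_int.integrableOn h_int.integrableOn]
  have hneg := integral_comp_neg_Ioi 0
    (fun u : ℝ => exp (t * I * u) * ((2 * Real.cosh u : ℝ) : ℂ) ^ (-s))
  rw [neg_zero] at hneg
  rw [← hneg, ← integral_add h_int.comp_neg.integrableOn h_int.integrableOn,
    show (4 : ℂ) = 2 * 2 by norm_num, mul_assoc, ← integral_const_mul (2 : ℂ)]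
  congr 3
  ext u
  rw [Complex.cosh, Real.cosh_neg, ofReal_neg, mul_neg]
  ring

theorem integrable_KBessel_mellin_integrand {s : ℂ} (hs : 0 < s.re) (t : ℝ) :
    Integrable (fun p : ℝ × ℝ => (p.1 : ℂ) ^ (s - 1) *
      (exp (-(p.1 : ℂ) * (Real.cosh p.2 : ℂ)) * cosh (t * I * p.2)))
      ((volume.restrict (Ioi 0)).prod (volume.restrict (Ioi 0))) := by
  have hbound (u x : ℝ) (hx : 0 < x) : ‖(x : ℂ) ^ (s - 1) *
      (exp (-(x : ℂ) * (Real.cosh u : ℂ)) * cosh (t * I * u))‖ ≤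
      x ^ (s.re - 1) * Real.exp (-(Real.cosh u * x)) := by
    rw [norm_mul, norm_mul, norm_cpow_eq_rpow_re_of_pos hx, sub_re, one_re, ← ofReal_neg,
      ← ofReal_mul, norm_exp_ofReal, neg_mul, mul_comm x]
    gcongr
    exact mul_le_of_le_one_right (Real.exp_pos _).le (norm_cosh_ofReal_mul_I_mul_le_one t u)
  have hgamma (u : ℝ) : IntegrableOn
      (fun x : ℝ => x ^ (s.re - 1) * Real.exp (-(Real.cosh u * x))) (Ioi 0) := by
    simpa using integrableOn_rpow_mul_exp_neg_mul_rpow (s := s.re - 1) (by linarith) zero_lt_one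
      (Real.cosh_pos u)
  have hmeas : Measurable (fun p : ℝ × ℝ => (p.1 : ℂ) ^ (s - 1) *
      (exp (-(p.1 : ℂ) * (Real.cosh p.2 : ℂ)) * cosh (t * I * p.2))) := by fun_prop
  rw [integrable_prod_iff' hmeas.aestronglyMeasurable]
  refine ⟨.of_forall fun u => (hgamma u).mono' (by fun_prop)
    (ae_restrict_of_forall_mem measurableSet_Ioi fun x hx => hbound u x hx), ?_⟩
  refine (((integrable_exp_neg_mul_abs hs).integrableOn (s := Ioi 0)).const_mul
    (2 ^ s.re * Real.Gamma s.re)).mono'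
    hmeas.norm.stronglyMeasurable.integral_prod_left'.aestronglyMeasurable
    (.of_forall fun u => ?_)
  have hc := Real.cosh_pos u
  have hnorm : ‖((2 * Real.cosh u : ℝ) : ℂ) ^ (-s)‖ = (2 ^ s.re)⁻¹ * (1 / Real.cosh u) ^ s.re := by
    rw [norm_cpow_eq_rpow_re_of_pos (by positivity), neg_re, Real.mul_rpow two_pos.le hc.le,
      Real.rpow_neg two_pos.le, Real.rpow_neg hc.le, one_div, Real.inv_rpow hc.le]
  have h2 : (0 : ℝ) < 2 ^ s.re := by positivity
  have hG := Real.Gamma_pos_of_pos hs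
  rw [Real.norm_of_nonneg (integral_nonneg fun _ => norm_nonneg _)]
  calc _ ≤ ∫ x in Ioi (0 : ℝ), x ^ (s.re - 1) * Real.exp (-(Real.cosh u * x)) := by
        refine setIntegral_mono_on ((hgamma u).mono' (by fun_prop) ?_) (hgamma u) measurableSet_Ioi
          fun x hx => hbound u x hx
        exact ae_restrict_of_forall_mem measurableSet_Ioi fun x hx => by
          rw [norm_norm]; exact hbound u x hx
    _ = 2 ^ s.re * Real.Gamma s.re * ‖((2 * Real.cosh u : ℝ) : ℂ) ^ (-s)‖ := by
        rw [Real.integral_rpow_mul_exp_neg_mul_Ioi hs hc, hnorm]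
        field_simp
    _ ≤ _ := by gcongr; exact norm_two_mul_cosh_cpow_le hs u

theorem mellinConvergent_KBessel {s : ℂ} (hs : 0 < s.re) (t : ℝ) :
    MellinConvergent (KBessel (t * I)) s := by
  have := (integrable_KBessel_mellin_integrand hs t).integral_prod_left
  simpa only [integral_const_mul] using! this

theorem mellin_KBessel {s : ℂ} (hs : 0 < s.re) (t : ℝ) :
    mellin (KBessel (t * I)) s =
      2 ^ s / 4 * (Gamma ((s + t * I) / 2) * Gamma ((s - t * I) / 2)) := by
  have hswap := integral_integral_swap (f := fun x u : ℝ => (x : ℂ) ^ (s - 1) *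
      (exp (-(x : ℂ) * (Real.cosh u : ℂ)) * cosh (t * I * u)))
      (integrable_KBessel_mellin_integrand hs t)
  simp only [integral_const_mul] at hswap
  simp only [mellin, KBessel, smul_eq_mul]
  rw [hswap, ← integral_cosh_mul_two_mul_cosh_cpow hs,
    show ∀ J : ℂ, 2 ^ s / 4 * (Gamma s * (4 * J)) = (2 ^ s * Gamma s) * J by intro J; ring,
    ← integral_const_mul]
  congr 1
  ext u
  have hc := Real.cosh_pos u
  have hpow : (1 / (Real.cosh u : ℂ)) ^ s = 2 ^ s * ((2 * Real.cosh u : ℝ) : ℂ) ^ (-s) := by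
    rw [cpow_neg, ofReal_mul, mul_cpow_ofReal_nonneg two_pos.le hc.le, ofReal_ofNat, one_div,
      inv_cpow _ _ (arg_ofReal_of_nonneg hc.le ▸ Real.pi_pos.ne)]
    have h2 : (2 : ℂ) ^ s ≠ 0 := by simp [cpow_eq_zero_iff]
    field_simp
  calc _ = ∫ x in Ioi (0 : ℝ), cosh (t * I * u) * ((x : ℂ) ^ (s - 1) *
        exp (-((Real.cosh u : ℂ) * x))) := by
        congr 1
        ext x
        ring_nf
    _ = _ := by
        rw [integral_const_mul, Complex.integral_cpow_mul_exp_neg_mul_Ioi hs hc, hpow]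
        ring

theorem W2_eq (μ : ℂ) {y : ℝ} (hy : 0 < y) :
    W2 μ y = 2 * ((y : ℂ) ^ (1 / 2 : ℂ) • KBessel μ (2 * Real.pi * y)) := by
  rw [W2, Real.sqrt_eq_rpow, ofReal_cpow hy.le, smul_eq_mul, mul_assoc]
  norm_num

theorem mellinConvergent_W2 {w : ℂ} (hw : -(1 / 2) < w.re) (t : ℝ) :
    MellinConvergent (W2 (t * I)) w := by
  have hs : 0 < (w + 1 / 2).re := by simp; linarith
  have h := (MellinConvergent.comp_mul_left Real.two_pi_pos).2 (mellinConvergent_KBessel hs t)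
  refine ((MellinConvergent.cpow_smul.2 h).const_smul (2 : ℂ)).congr_fun (fun y hy => ?_)
    measurableSet_Ioi
  simp only [W2_eq _ (mem_Ioi.1 hy), smul_eq_mul]

theorem mellin_W2 {w : ℂ} (hw : -(1 / 2) < w.re) (t : ℝ) :
    mellin (W2 (t * I)) w = (Real.pi : ℂ) ^ (-w - 1 / 2) / 2 *
      (Gamma ((w + 1 / 2 + t * I) / 2) * Gamma ((w + 1 / 2 - t * I) / 2)) := by
  have hs : 0 < (w + 1 / 2).re := by simp; linarith
  have h : mellin (W2 (t * I)) w = mellin (fun y => (2 : ℂ) •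
      ((y : ℂ) ^ (1 / 2 : ℂ) • KBessel (t * I) (2 * Real.pi * y))) w :=
    setIntegral_congr_fun measurableSet_Ioi fun y hy => by
      simp only [W2_eq _ (mem_Ioi.1 hy), smul_eq_mul]
  rw [h, mellin_const_smul, mellin_cpow_smul, mellin_comp_mul_left _ _ Real.two_pi_pos,
    mellin_KBessel hs, ofReal_mul, ofReal_ofNat]
  have hmul : ((2 : ℂ) * Real.pi) ^ (-(w + 1 / 2)) =
      (2 ^ (w + 1 / 2))⁻¹ * (Real.pi : ℂ) ^ (-w - 1 / 2) := by
    have := mul_cpow_ofReal_nonneg two_pos.le Real.pi_pos.le (-(w + 1 / 2))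
    rw [ofReal_ofNat] at this
    rw [this, cpow_neg, neg_add']
  have h2 : (2 : ℂ) ^ (w + 1 / 2) ≠ 0 := by simp [cpow_eq_zero_iff]
  rw [hmul]
  simp only [smul_eq_mul]
  field_simp
  norm_num

theorem norm_KBessel_le (t : ℝ) {x : ℝ} (hx : 0 < x) :
    ‖KBessel (t * I) x‖ ≤ ‖KBessel 0 x‖ := by
  have hnorm (u : ℝ) : ‖exp (-(x : ℂ) * (Real.cosh u : ℂ))‖ = Real.exp (-x * Real.cosh u) := by
    rw [← ofReal_neg, ← ofReal_mul, norm_exp_ofReal]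
  have h_int : IntegrableOn (fun u : ℝ => Real.exp (-x * Real.cosh u)) (Ioi 0) := by
    refine (exp_neg_integrableOn_Ioi 0 hx).mono' (by fun_prop)
      (ae_restrict_of_forall_mem measurableSet_Ioi fun u hu => ?_)
    have := (Real.self_le_sinh_iff.2 (le_of_lt hu)).trans (Real.sinh_lt_cosh u).le
    rw [Real.norm_of_nonneg (Real.exp_pos _).le, neg_mul, neg_mul]
    gcongr
  have h0 : ‖KBessel 0 x‖ = ∫ u in Ioi (0 : ℝ), Real.exp (-x * Real.cosh u) := by
    have : KBessel 0 x = ((∫ u in Ioi (0 : ℝ), Real.exp (-x * Real.cosh u) : ℝ) : ℂ) := by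
      rw [← integral_complex_ofReal]
      simp [KBessel]
    rw [this, norm_real, Real.norm_of_nonneg (integral_nonneg fun _ => (Real.exp_pos _).le)]
  rw [h0]
  refine norm_integral_le_of_norm_le h_int (.of_forall fun u => ?_)
  rw [norm_mul, hnorm]
  exact mul_le_of_le_one_right (Real.exp_pos _).le (norm_cosh_ofReal_mul_I_mul_le_one t u)

theorem norm_W2_le (t : ℝ) {y : ℝ} (hy : 0 < y) : ‖W2 (t * I) y‖ ≤ ‖W2 0 y‖ := by
  simp only [W2, norm_mul]
  gcongr
  exact norm_KBessel_le t (by positivity)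

theorem measurable_W2 : Measurable fun p : ℝ × ℝ => W2 (p.1 * I) p.2 := by
  have h : StronglyMeasurable fun p : ℝ × ℝ => KBessel (p.1 * I) (2 * Real.pi * p.2) := by
    refine StronglyMeasurable.integral_prod_right (f := fun (p : ℝ × ℝ) (u : ℝ) =>
      exp (-((2 * Real.pi * p.2 : ℝ) : ℂ) * (Real.cosh u : ℂ)) * cosh (p.1 * I * u)) ?_
    exact Continuous.stronglyMeasurable (by simp only [Function.uncurry_def]; fun_prop)
  exact Measurable.mul (by fun_prop) h.measurable

/-- Mellin transform of the inverse Kontorovich–Lebedev transform: for `H ∈ C_η` and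
`−1/2 < Re w < η`, the Mellin transform of `h := H^♭` converges absolutely and equals
`(π^{−w−1/2}/4)·(1/(2π)) ∫_ℝ H(it) Γ((w+1/2+it)/2)Γ((w+1/2−it)/2)/(Γ(it)Γ(−it)) dt`. -/
theorem mellin_of_Hflat (η : ℝ) (hη : 40 < η) (H : ℂ → ℂ) (hH : MemCeta η H)
    (w : ℂ) (hw₁ : -(1/2) < w.re) (hw₂ : w.re < η) :
    IntegrableOn (fun y : ℝ => Hflat H y * (y : ℂ) ^ (w - 1)) (Ioi 0) ∧
    ∫ y in Ioi (0:ℝ), Hflat H y * (y : ℂ) ^ (w - 1) =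
      ((Real.pi : ℂ) ^ (-w - 1/2) / 4) * ((1 / (2 * (Real.pi : ℂ))) *
        ∫ t : ℝ, H (t * I) * Complex.Gamma ((w + 1/2 + t * I) / 2) *
          Complex.Gamma ((w + 1/2 - t * I) / 2) /
          (Complex.Gamma (t * I) * Complex.Gamma (-(t * I)))) := by
  set g : ℝ → ℂ := fun t => H (t * I) / (Gamma (t * I) * Gamma (-(t * I))) with hg_def
  have hg : Integrable g := hH.integrable_div_Gamma (by linarith)
  have hW0 : IntegrableOn (fun y : ℝ => (y : ℂ) ^ (w - 1) * W2 0 y) (Ioi 0) := by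
    have := mellinConvergent_W2 hw₁ 0
    simpa [MellinConvergent] using! this
  have h_int : Integrable (fun p : ℝ × ℝ => g p.2 * ((p.1 : ℂ) ^ (w - 1) * W2 (p.2 * I) p.1))
      ((volume.restrict (Ioi 0)).prod volume) := by
    refine (hW0.norm.mul_prod hg.norm).mono' ?_ ?_
    · refine hg.aestronglyMeasurable.comp_snd.mul (Measurable.aestronglyMeasurable ?_)
      exact Measurable.mul (by fun_prop) (measurable_W2.comp measurable_swap)
    · have : ∀ᵐ p : ℝ × ℝ ∂((volume.restrict (Ioi 0)).prod volume), p.1 ∈ Ioi (0 : ℝ) :=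
        Measure.quasiMeasurePreserving_fst.ae (ae_restrict_mem measurableSet_Ioi)
      filter_upwards [this] with p hp
      rw [norm_mul, norm_mul, norm_mul, mul_comm]
      gcongr
      exact norm_W2_le _ hp
  have hflat (y : ℝ) : Hflat H y * (y : ℂ) ^ (w - 1) =
      (1 / (4 * (Real.pi : ℂ))) * ∫ t : ℝ, g t * ((y : ℂ) ^ (w - 1) * W2 (t * I) y) := by
    rw [Hflat, mul_assoc, ← integral_mul_const]
    congr 2
    ext t
    simp only [hg_def]
    ring
  simp only [hflat]
  refine ⟨h_int.integral_prod_left.const_mul _, ?_⟩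
  rw [integral_const_mul, integral_integral_swap (f := fun (y t : ℝ) =>
    g t * ((y : ℂ) ^ (w - 1) * W2 (t * I) y)) h_int]
  have hmellin (t : ℝ) : ∫ y in Ioi (0 : ℝ), g t * ((y : ℂ) ^ (w - 1) * W2 (t * I) y) =
      (Real.pi : ℂ) ^ (-w - 1 / 2) / 2 * (H (t * I) * Gamma ((w + 1 / 2 + t * I) / 2) *
        Gamma ((w + 1 / 2 - t * I) / 2) / (Gamma (t * I) * Gamma (-(t * I)))) := by
    have := mellin_W2 hw₁ t
    simp only [mellin, smul_eq_mul] at this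
    rw [integral_const_mul, this]
    simp only [hg_def]
    ring
  simp only [hmellin]
  rw [integral_const_mul]
  ring
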